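/- arXiv:2207.14270 — 2 statements merged into one kernel-verified Lean document; each statement's English description precedes it below -/
import Mathlib

section
/- Let u, v, r ∈ R such that ug + vs = r, and let h ∈ R be such that hu = κ, hv = λ and hr = ω, where κ is given by the key equation ω = κg + λs. Let k ∈ {0, …, n−1} be such that x − α_k does not right-divide v but x − α_k right-divides λ. Set v' = lclm(x − α_k, v), let h'' ∈ R with h''v = v', and define u' = h''u and r' = h''r. Then u'g + v's = r', and there exists h' ∈ R with h'u' = κ, h'v' = λ and h'r' = ω. -/
/-- `δ` is a `σ`-derivation of the field `L`. -/
def IsSigmaDerivation {L : Type*} [Field L] (σ : L ≃+* L) (δ : L → L) : Prop :=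
  (∀ a b : L, δ (a + b) = δ a + δ b) ∧ ∀ a b : L, δ (a * b) = σ a * δ b + δ a * b

/-- The ring `R`, together with the embedding of constants `C : L →+* R` and the
element `X`, is the Ore extension `L[x;σ,δ]`: the twisting rule
`X * C a = C (σ a) * X + C (δ a)` holds and every element of `R` is, in a unique way,
a left `L`-linear combination of the powers of `X`. -/
structure IsOreExtension {L : Type*} [Field L] (σ : L ≃+* L) (δ : L → L)
    (R : Type*) [Ring R] (C : L →+* R) (X : R) : Prop where
  twist : ∀ a : L, X * C a = C (σ a) * X + C (δ a)
  repr_unique : ∀ r : R, ∃! f : ℕ →₀ L, r = f.sum fun n a => C a * X ^ n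

/-- The degree of an Ore polynomial (`⊥` for the zero polynomial). -/
noncomputable def IsOreExtension.deg {L : Type*} [Field L] {σ : L ≃+* L} {δ : L → L}
    {R : Type*} [Ring R] {C : L →+* R} {X : R}
    (H : IsOreExtension σ δ R C X) (r : R) : WithBot ℕ :=
  (H.repr_unique r).exists.choose.support.max

/-- `f` is a right divisor of `g` : `g = u * f` for some `u`. -/
def RDvd {R : Type*} [Ring R] (f g : R) : Prop := ∃ u, g = u * f

/-- `f` is a left divisor of `g` : `g = f * u` for some `u`. -/
def LDvd {R : Type*} [Ring R] (f g : R) : Prop := ∃ u, g = f * u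

/-- `m` is a least common left multiple of the family `f`. -/
def IsLclm {R : Type*} [Ring R] {ι : Type*} (f : ι → R) (m : R) : Prop :=
  (∀ i, RDvd (f i) m) ∧ ∀ m' : R, (∀ i, RDvd (f i) m') → RDvd m m'

/-- `m` is a least common right multiple of the family `f`. -/
def IsLcrm {R : Type*} [Ring R] {ι : Type*} (f : ι → R) (m : R) : Prop :=
  (∀ i, LDvd (f i) m) ∧ ∀ m' : R, (∀ i, LDvd (f i) m') → LDvd m m'

/-- `gcld (f, g) = 1`, i.e. `fR + gR = R`. -/
def LCoprime {R : Type*} [Ring R] (f g : R) : Prop := ∃ a b : R, f * a + g * b = 1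

/-- `gcrd (f, g) = 1`, i.e. `Rf + Rg = R`. -/
def RCoprime {R : Type*} [Ring R] (f g : R) : Prop := ∃ a b : R, a * f + b * g = 1

namespace IsOreExtension

variable {L : Type*} [Field L] {σ : L ≃+* L} {δ : L → L}
  {R : Type*} [Ring R] {C : L →+* R} {X : R}

/-- The additive subgroup of Ore polynomials of degree less than `n`. -/
def degreeLT (C : L →+* R) (X : R) (n : ℕ) : AddSubgroup R :=
  AddSubgroup.closure {r | ∃ a : L, ∃ i < n, r = C a * X ^ i}

theorem C_mul_X_pow_mem_degreeLT (a : L) {i n : ℕ} (hi : i < n) :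
    C a * X ^ i ∈ degreeLT C X n :=
  AddSubgroup.subset_closure ⟨a, i, hi, rfl⟩

theorem degreeLT_mono {m n : ℕ} (hmn : m ≤ n) : degreeLT C X m ≤ degreeLT C X n := by
  refine (AddSubgroup.closure_le _).2 ?_
  rintro _ ⟨a, i, hi, rfl⟩
  exact C_mul_X_pow_mem_degreeLT a (hi.trans_le hmn)

theorem C_mul_mem_degreeLT (a : L) {n : ℕ} {q : R} (hq : q ∈ degreeLT C X n) :
    C a * q ∈ degreeLT C X n := by
  suffices h : degreeLT C X n ≤ (degreeLT C X n).comap (AddMonoidHom.mulLeft (C a)) from h hq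
  refine (AddSubgroup.closure_le _).2 ?_
  rintro _ ⟨b, i, hi, rfl⟩
  change C a * (C b * X ^ i) ∈ degreeLT C X n
  rw [← mul_assoc, ← map_mul]
  exact C_mul_X_pow_mem_degreeLT _ hi

theorem X_mul_mem_degreeLT (H : IsOreExtension σ δ R C X) {n : ℕ} {q : R}
    (hq : q ∈ degreeLT C X n) : X * q ∈ degreeLT C X (n + 1) := by
  suffices h : degreeLT C X n ≤ (degreeLT C X (n + 1)).comap (AddMonoidHom.mulLeft X) from h hq
  refine (AddSubgroup.closure_le _).2 ?_
  rintro _ ⟨b, i, hi, rfl⟩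
  change X * (C b * X ^ i) ∈ degreeLT C X (n + 1)
  rw [← mul_assoc, H.twist, add_mul, mul_assoc, ← pow_succ']
  exact add_mem (C_mul_X_pow_mem_degreeLT _ (by omega)) (C_mul_X_pow_mem_degreeLT _ (by omega))

theorem X_pow_mul_mem_degreeLT (H : IsOreExtension σ δ R C X) (m : ℕ) {n : ℕ} {q : R}
    (hq : q ∈ degreeLT C X n) : X ^ m * q ∈ degreeLT C X (m + n) := by
  induction m with
  | zero => simpa using hq
  | succ m ih =>
    rw [pow_succ', mul_assoc]
    exact degreeLT_mono (by omega) (H.X_mul_mem_degreeLT ih)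

theorem mul_mem_degreeLT (H : IsOreExtension σ δ R C X) {m n : ℕ} {p q : R}
    (hp : p ∈ degreeLT C X m) (hq : q ∈ degreeLT C X (n + 1)) :
    p * q ∈ degreeLT C X (m + n) := by
  suffices h : degreeLT C X m ≤ (degreeLT C X (m + n)).comap (AddMonoidHom.mulRight q) from h hp
  refine (AddSubgroup.closure_le _).2 ?_
  rintro _ ⟨b, i, hi, rfl⟩
  change C b * X ^ i * q ∈ degreeLT C X (m + n)
  rw [mul_assoc]
  exact C_mul_mem_degreeLT _ (degreeLT_mono (by omega) (H.X_pow_mul_mem_degreeLT i hq))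

theorem X_pow_mul_C_mul_X_pow_sub_mem (H : IsOreExtension σ δ R C X) (m n : ℕ) (a : L) :
    X ^ m * (C a * X ^ n) - C (σ^[m] a) * X ^ (m + n) ∈ degreeLT C X (m + n) := by
  induction m with
  | zero => simp
  | succ m ih =>
    have key : X ^ (m + 1) * (C a * X ^ n) - C (σ^[m + 1] a) * X ^ (m + 1 + n) =
        X * (X ^ m * (C a * X ^ n) - C (σ^[m] a) * X ^ (m + n)) +
          C (δ (σ^[m] a)) * X ^ (m + n) := by
      have h := H.twist (σ^[m] a)
      rw [Function.iterate_succ_apply', show m + 1 + n = (m + n) + 1 by omega, pow_succ' X (m + n),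
        pow_succ', mul_sub, ← mul_assoc X (C _), h]
      noncomm_ring
    rw [key]
    exact add_mem (degreeLT_mono (by omega) (H.X_mul_mem_degreeLT ih))
      (C_mul_X_pow_mem_degreeLT _ (by omega))

theorem exists_sub_mem_degreeLT (H : IsOreExtension σ δ R C X) {r : R} (hr : r ≠ 0) :
    ∃ n, ∃ a : L, a ≠ 0 ∧ r - C a * X ^ n ∈ degreeLT C X n := by
  obtain ⟨f, hf, -⟩ := H.repr_unique r
  have hne : f.support.Nonempty := by
    rw [Finsupp.support_nonempty_iff]
    rintro rfl
    exact hr (by simpa using hf)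
  have hmem := f.support.max'_mem hne
  refine ⟨f.support.max' hne, f (f.support.max' hne), Finsupp.mem_support_iff.1 hmem, ?_⟩
  rw [hf, Finsupp.sum, ← Finset.add_sum_erase _ _ hmem, add_sub_cancel_left]
  exact sum_mem fun i hi => C_mul_X_pow_mem_degreeLT _ (Finset.lt_max'_of_mem_erase_max' _ hne hi)

theorem exists_finsupp_of_mem_degreeLT {n : ℕ} {r : R} (hr : r ∈ degreeLT C X n) :
    ∃ f : ℕ →₀ L, (r = f.sum fun i a => C a * X ^ i) ∧ f n = 0 := by
  induction hr using AddSubgroup.closure_induction with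
  | mem r hr =>
    obtain ⟨a, i, hi, rfl⟩ := hr
    exact ⟨Finsupp.single i a, by simp, Finsupp.single_eq_of_ne hi.ne'⟩
  | zero => exact ⟨0, by simp, rfl⟩
  | add p q _ _ hp hq =>
    obtain ⟨f, rfl, hf⟩ := hp
    obtain ⟨f', rfl, hf'⟩ := hq
    exact ⟨f + f', (Finsupp.sum_add_index' (by simp) (by simp [add_mul])).symm, by simp [hf, hf']⟩
  | neg p _ hp =>
    obtain ⟨f, rfl, hf⟩ := hp
    refine ⟨-f, ?_, by simp [hf]⟩
    rw [Finsupp.sum_neg_index (by simp)]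
    simp [Finsupp.sum]

theorem eq_zero_of_C_mul_X_pow_mem (H : IsOreExtension σ δ R C X) {n : ℕ} {a : L}
    (ha : C a * X ^ n ∈ degreeLT C X n) : a = 0 := by
  obtain ⟨f, hf, hfn⟩ := exists_finsupp_of_mem_degreeLT ha
  have h : Finsupp.single n a = f := (H.repr_unique _).unique (by simp) hf
  simpa [← h] using hfn

/-- An Ore extension of a field has no zero divisors. -/
theorem noZeroDivisors (H : IsOreExtension σ δ R C X) : NoZeroDivisors R where
  eq_zero_or_eq_zero_of_mul_eq_zero {p q} hpq := by
    by_contra! hne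
    obtain ⟨m, a, ha, hp⟩ := H.exists_sub_mem_degreeLT hne.1
    obtain ⟨n, b, hb, hq⟩ := H.exists_sub_mem_degreeLT hne.2
    have hq' : q ∈ degreeLT C X (n + 1) := by
      rw [← sub_add_cancel q (C b * X ^ n)]
      exact add_mem (degreeLT_mono n.le_succ hq) (C_mul_X_pow_mem_degreeLT b n.lt_succ_self)
    have hlead : C (a * σ^[m] b) * X ^ (m + n) =
        p * q - ((p - C a * X ^ m) * q + C a * (X ^ m * (q - C b * X ^ n)) +
          C a * (X ^ m * (C b * X ^ n) - C (σ^[m] b) * X ^ (m + n))) := by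
      rw [map_mul]
      noncomm_ring
    have hmem : C (a * σ^[m] b) * X ^ (m + n) ∈ degreeLT C X (m + n) := by
      rw [hlead, hpq, zero_sub]
      exact neg_mem (add_mem (add_mem (H.mul_mem_degreeLT hp hq')
        (C_mul_mem_degreeLT a (H.X_pow_mul_mem_degreeLT m hq)))
        (C_mul_mem_degreeLT a (H.X_pow_mul_C_mul_X_pow_sub_mem m n b)))
    have hzero := H.eq_zero_of_C_mul_X_pow_mem hmem
    have hσ : σ^[m] b ≠ 0 := fun h0 =>
      hb (σ.injective.iterate m (h0.trans (iterate_map_zero σ m).symm))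
    exact mul_ne_zero ha hσ hzero

end IsOreExtension

/-- Proposition 12 of the paper (adding a new right root to `v`): if
`u * g + v * s = r` with `h * u = κ`, `h * v = lam`, `h * r = ω`, and `x - α kk`
right-divides `lam` but not `v`, then setting `v' = lclm (x - α kk, v)`,
`u' = h'' * u`, `r' = h'' * r` (where `h'' * v = v'`), the relation
`u' * g + v' * s = r'` holds and `κ`, `lam`, `ω` are still obtained from `u'`,
`v'`, `r'` by a common left multiplier `h'`. -/
theorem adding_new_root
    {L : Type*} [Field L] (σ : L ≃+* L) (δ : L → L) (hδ : IsSigmaDerivation σ δ)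
    {R : Type*} [Ring R] (C : L →+* R) (X : R) (H : IsOreExtension σ δ R C X)
    (F : Subfield L) (n : ℕ) (α : Fin n → L) (hα : Function.Injective α)
    (g : R) (hg0 : g ≠ 0)
    (hginv : ∀ a : R, ∃ b : R, a * g = g * b) (hginv' : ∀ a : R, ∃ b : R, g * a = b * g)
    (hcop : ∀ i, RCoprime (X - C (α i)) g)
    (hp : Fin n → R) (hpdeg : ∀ i, H.deg (hp i) < H.deg g)
    (hpinv : ∀ i, ∃ w : R, (X - C (α i)) * hp i - 1 = w * g)
    (η : Fin n → L) (hη : ∀ i, η i ≠ 0)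
    (c e y : Fin n → L) (hcF : ∀ i, c i ∈ F) (heF : ∀ i, e i ∈ F)
    (hcode : ∑ i, hp i * C (η i) * C (c i) = 0)
    (ν : ℕ) (k : Fin ν → Fin n) (hk : Function.Injective k)
    (hek : ∀ j, e (k j) ≠ 0) (hesupp : ∀ i, (∀ j, k j ≠ i) → e i = 0)
    (hy : y = c + e)
    (s : R) (hs : s = ∑ i, hp i * C (η i) * C (y i))
    (lam : R) (hlam : IsLclm (fun j : Fin ν => X - C (α (k j))) lam)
    (ρ : Fin ν → R) (hρ : ∀ j, lam = ρ j * (X - C (α (k j))))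
    (ω : R) (hω : ω = ∑ j, ρ j * C (η (k j)) * C (e (k j)))
    (χ : ℕ) (hχ : H.deg g = (χ : WithBot ℕ)) (hν : ν ≤ χ / 2)
    (κ : R) (hκ : ω = κ * g + lam * s)
    (u v r h : R) (huvr : u * g + v * s = r)
    (hhu : h * u = κ) (hhv : h * v = lam) (hhr : h * r = ω)
    (kk : Fin n) (hknd : ¬ RDvd (X - C (α kk)) v) (hkd : RDvd (X - C (α kk)) lam)
    (v' : R) (hv' : IsLclm ![X - C (α kk), v] v')
    (h'' : R) (hh'' : h'' * v = v')
    (u' r' : R) (hu' : u' = h'' * u) (hr' : r' = h'' * r) :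
    u' * g + v' * s = r' ∧ ∃ h' : R, h' * u' = κ ∧ h' * v' = lam ∧ h' * r' = ω := by
  have := H.noZeroDivisors
  have hv0 : v ≠ 0 := by
    rintro rfl
    exact hknd ⟨0, (zero_mul _).symm⟩
  obtain ⟨w, hw⟩ := hv'.2 lam (Fin.forall_fin_two.2 ⟨hkd, h, hhv.symm⟩)
  have hh : w * h'' = h := by
    refine mul_right_cancel₀ hv0 ?_
    rw [mul_assoc, hh'', ← hw, hhv]
  refine ⟨?_, w, ?_, hw.symm, ?_⟩
  · rw [hu', ← hh'', hr', ← huvr, mul_add, mul_assoc, mul_assoc]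
  · rw [hu', ← mul_assoc, hh, hhu]
  · rw [hr', ← mul_assoc, hh, hhr]
end

section
/- Given a ∈ L*, the left P-independent subsets of Δ(a) are exactly those of the form {ᶜ¹a, …, ᶜᵐa} where m ≤ μ and {c_1, …, c_m} is a K-linearly independent subset of L. Moreover, such a set has m = μ elements if and only if lclm{x − ᶜ¹a, …, x − ᶜᵐa} = x^μ − N(a). -/
/-- The norm `N a = a · σ a · … · σ^{μ-1} a`. -/
def Nrm {L : Type*} [Field L] (σ : L ≃+* L) (μ : ℕ) (a : L) : L :=
  ∏ i ∈ Finset.range μ, (⇑σ)^[i] a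

/-- The conjugacy class `Δ(a) = { σ c * a * c⁻¹ : c ∈ L* }`. -/
def Delta {L : Type*} [Field L] (σ : L ≃+* L) (a : L) : Set L :=
  {b : L | ∃ c : L, c ≠ 0 ∧ b = σ c * a * c⁻¹}

namespace IsOreExtension

section Coefficients

variable {L : Type*} [Field L] {σ : L ≃+* L} {δ : L → L} {R : Type*} [Ring R]
  {C : L →+* R} {X : R}

/-- The coefficients of an Ore polynomial. -/
noncomputable def coeff (H : IsOreExtension σ δ R C X) (r : R) : ℕ →₀ L :=
  (H.repr_unique r).exists.choose

theorem coeff_spec (H : IsOreExtension σ δ R C X) (r : R) :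
    r = (H.coeff r).sum fun n a => C a * X ^ n :=
  (H.repr_unique r).exists.choose_spec

theorem coeff_eq_of_eq_sum (H : IsOreExtension σ δ R C X) {r : R} {f : ℕ →₀ L}
    (h : r = f.sum fun n a => C a * X ^ n) : H.coeff r = f :=
  (H.repr_unique r).unique (H.coeff_spec r) h

theorem coeff_add (H : IsOreExtension σ δ R C X) (r s : R) :
    H.coeff (r + s) = H.coeff r + H.coeff s := by
  apply H.coeff_eq_of_eq_sum
  rw [Finsupp.sum_add_index' (by simp) (by simp [add_mul]), ← H.coeff_spec, ← H.coeff_spec]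

theorem coeff_C_mul_X_pow (H : IsOreExtension σ δ R C X) (b : L) (n : ℕ) :
    H.coeff (C b * X ^ n) = Finsupp.single n b := by
  apply H.coeff_eq_of_eq_sum
  rw [Finsupp.sum_single_index (by simp)]

theorem coeff_zero (H : IsOreExtension σ δ R C X) : H.coeff 0 = 0 :=
  H.coeff_eq_of_eq_sum (by simp)

theorem coeff_sub (H : IsOreExtension σ δ R C X) (r s : R) :
    H.coeff (r - s) = H.coeff r - H.coeff s := by
  rw [eq_sub_iff_add_eq, ← coeff_add, sub_add_cancel]

theorem coeff_X_pow (H : IsOreExtension σ δ R C X) (n : ℕ) :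
    H.coeff (X ^ n) = Finsupp.single n 1 := by
  simpa using H.coeff_C_mul_X_pow 1 n

theorem coeff_C (H : IsOreExtension σ δ R C X) (b : L) :
    H.coeff (C b) = Finsupp.single 0 b := by
  simpa using H.coeff_C_mul_X_pow b 0

theorem coeff_eq_zero_iff (H : IsOreExtension σ δ R C X) {r : R} : H.coeff r = 0 ↔ r = 0 := by
  refine ⟨fun h => ?_, fun h => h ▸ H.coeff_zero⟩
  rw [H.coeff_spec r, h, Finsupp.sum_zero_index]

/-- To prove an additive property of Ore polynomials it suffices to prove it for monomials. -/
theorem induction_monomial (H : IsOreExtension σ δ R C X) {P : R → Prop} (r : R)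
    (zero : P 0) (add : ∀ r s, P r → P s → P (r + s)) (monomial : ∀ b n, P (C b * X ^ n)) :
    P r := by
  rw [H.coeff_spec r, Finsupp.sum]
  exact Finset.sum_induction _ P add zero fun n _ => monomial _ n

theorem deg_eq_coe_iff (H : IsOreExtension σ δ R C X) {r : R} {n : ℕ} :
    H.deg r = (n : WithBot ℕ) ↔ H.coeff r n ≠ 0 ∧ ∀ k, n < k → H.coeff r k = 0 := by
  change (H.coeff r).support.max = _ ↔ _
  constructor
  · intro h
    refine ⟨Finsupp.mem_support_iff.1 (Finset.mem_of_max h), fun k hk => ?_⟩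
    exact Finsupp.notMem_support_iff.1 (Finset.notMem_of_max_lt hk h)
  · rintro ⟨h, h'⟩
    refine le_antisymm (Finset.max_le fun k hk => ?_) (Finset.le_max (by simpa using h))
    by_contra hlt
    exact Finsupp.mem_support_iff.1 hk (h' k (WithBot.coe_lt_coe.1 (not_le.1 hlt)))

theorem exists_deg_eq (H : IsOreExtension σ δ R C X) {r : R} (hr : r ≠ 0) :
    ∃ n : ℕ, H.deg r = (n : WithBot ℕ) :=
  Finset.max_of_nonempty (Finsupp.support_nonempty_iff.2 (H.coeff_eq_zero_iff.not.2 hr))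

theorem ne_zero_of_deg (H : IsOreExtension σ δ R C X) {r : R} {n : ℕ}
    (h : H.deg r = (n : WithBot ℕ)) : r ≠ 0 := by
  rintro rfl
  exact (H.deg_eq_coe_iff.1 h).1 (by simp [H.coeff_zero])

theorem deg_X_pow_sub_C (H : IsOreExtension σ δ R C X) {n : ℕ} (hn : 0 < n) (b : L) :
    H.deg (X ^ n - C b) = (n : WithBot ℕ) := by
  rw [H.deg_eq_coe_iff, H.coeff_sub, H.coeff_X_pow, H.coeff_C]
  refine ⟨by simp [hn.ne], fun k hk => ?_⟩
  simp [hk.ne, (hn.trans hk).ne]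

theorem deg_one (H : IsOreExtension σ δ R C X) : H.deg 1 = ((0 : ℕ) : WithBot ℕ) := by
  have := H.coeff_X_pow 0
  rw [pow_zero] at this
  rw [H.deg_eq_coe_iff, this]
  exact ⟨by simp, fun k hk => by simp [hk.ne]⟩

end Coefficients

section Multiplication

variable {L : Type*} [Field L] {σ : L ≃+* L} {R : Type*} [Ring R] {C : L →+* R} {X : R}

theorem X_pow_mul_C (H : IsOreExtension σ (fun _ => 0) R C X) (n : ℕ) (b : L) :
    X ^ n * C b = C ((⇑σ)^[n] b) * X ^ n := by
  induction n generalizing b with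
  | zero => simp
  | succ n ih =>
    have h := H.twist b
    rw [map_zero, add_zero] at h
    rw [pow_succ, mul_assoc, h, ← mul_assoc, ih, mul_assoc, Function.iterate_succ_apply]

theorem monomial_mul_monomial (H : IsOreExtension σ (fun _ => 0) R C X) (b c : L) (n k : ℕ) :
    C b * X ^ n * (C c * X ^ k) = C (b * (⇑σ)^[n] c) * X ^ (n + k) := by
  rw [mul_assoc, ← mul_assoc (X ^ n), H.X_pow_mul_C, map_mul, pow_add]
  simp only [mul_assoc]

theorem coeff_monomial_mul (H : IsOreExtension σ (fun _ => 0) R C X) (b : L) (n : ℕ) (s : R)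
    (j : ℕ) : H.coeff (C b * X ^ n * s) j =
      if n ≤ j then b * (⇑σ)^[n] (H.coeff s (j - n)) else 0 := by
  induction s using H.induction_monomial with
  | zero => simp [H.coeff_zero, iterate_map_zero]
  | add r s hr hs =>
    rw [mul_add, H.coeff_add, Finsupp.add_apply, hr, hs, H.coeff_add, Finsupp.add_apply,
      iterate_map_add]
    split_ifs <;> ring
  | monomial c k =>
    rw [H.monomial_mul_monomial, H.coeff_C_mul_X_pow, H.coeff_C_mul_X_pow,
      Finsupp.single_apply, Finsupp.single_apply]
    by_cases h : n + k = j
    · subst h; simp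
    · rw [if_neg h]
      split_ifs with h1 h2
      · omega
      · simp [iterate_map_zero]
      · rfl

theorem coeff_mul (H : IsOreExtension σ (fun _ => 0) R C X) (r s : R) (j : ℕ) :
    H.coeff (r * s) j = (H.coeff r).sum fun n b =>
      if n ≤ j then b * (⇑σ)^[n] (H.coeff s (j - n)) else 0 := by
  induction r using H.induction_monomial with
  | zero => simp [H.coeff_zero]
  | add r r' hr hr' =>
    rw [add_mul, H.coeff_add, Finsupp.add_apply, hr, hr', H.coeff_add,
      Finsupp.sum_add_index' (by simp)]
    intro n b c
    split_ifs <;> ring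
  | monomial b n =>
    rw [H.coeff_monomial_mul, H.coeff_C_mul_X_pow, Finsupp.sum_single_index (by simp)]

theorem deg_mul (H : IsOreExtension σ (fun _ => 0) R C X) {r s : R} {n k : ℕ}
    (hr : H.deg r = (n : WithBot ℕ)) (hs : H.deg s = (k : WithBot ℕ)) :
    H.deg (r * s) = ((n + k : ℕ) : WithBot ℕ) := by
  rw [H.deg_eq_coe_iff] at hr hs ⊢
  constructor
  · rw [H.coeff_mul, Finsupp.sum, Finset.sum_eq_single n]
    · rw [if_pos (Nat.le_add_right n k), Nat.add_sub_cancel_left]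
      refine mul_ne_zero hr.1 fun h => hs.1 ?_
      exact (σ.injective.iterate n) (h.trans (iterate_map_zero σ n).symm)
    · intro i hi hin
      have : i ≤ n := le_of_not_gt fun h => Finsupp.mem_support_iff.1 hi (hr.2 i h)
      rw [hs.2 (n + k - i) (by omega), iterate_map_zero]
      simp
    · intro h
      exact absurd (Finsupp.notMem_support_iff.1 h) hr.1
  · intro j hj
    rw [H.coeff_mul, Finsupp.sum]
    refine Finset.sum_eq_zero fun i hi => ?_
    have : i ≤ n := le_of_not_gt fun h => Finsupp.mem_support_iff.1 hi (hr.2 i h)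
    rw [hs.2 (j - i) (by omega), iterate_map_zero]
    simp

theorem deg_le_of_rDvd (H : IsOreExtension σ (fun _ => 0) R C X) {r s : R} {n k : ℕ}
    (hr : H.deg r = (n : WithBot ℕ)) (hs : H.deg s = (k : WithBot ℕ)) (h : RDvd r s) :
    n ≤ k := by
  obtain ⟨u, rfl⟩ := h
  obtain ⟨l, hl⟩ := H.exists_deg_eq (left_ne_zero_of_mul (H.ne_zero_of_deg hs))
  have := (H.deg_mul hl hr).symm.trans hs
  have : l + n = k := by exact_mod_cast this
  omega

theorem deg_eq_of_rDvd_rDvd (H : IsOreExtension σ (fun _ => 0) R C X) {r s : R} {n : ℕ}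
    (hr : H.deg r = (n : WithBot ℕ)) (h : RDvd r s) (h' : RDvd s r) :
    H.deg s = (n : WithBot ℕ) := by
  have hs : s ≠ 0 := by
    rintro rfl
    obtain ⟨u, hu⟩ := h'
    exact H.ne_zero_of_deg hr (by simpa using hu)
  obtain ⟨k, hk⟩ := H.exists_deg_eq hs
  rw [hk, le_antisymm (H.deg_le_of_rDvd hr hk h) (H.deg_le_of_rDvd hk hr h')]

theorem rDvd_symm_of_deg_eq (H : IsOreExtension σ (fun _ => 0) R C X) {r s : R} {n : ℕ}
    (hr : H.deg r = (n : WithBot ℕ)) (hs : H.deg s = (n : WithBot ℕ)) (h : RDvd r s) :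
    RDvd s r := by
  obtain ⟨u, rfl⟩ := h
  obtain ⟨l, hl⟩ := H.exists_deg_eq (left_ne_zero_of_mul (H.ne_zero_of_deg hs))
  have h1 := (H.deg_mul hl hr).symm.trans hs
  have h2 : l + n = n := by exact_mod_cast h1
  obtain rfl : l = 0 := by omega
  rw [H.deg_eq_coe_iff] at hl
  have hu : u = C (H.coeff u 0) := by
    have : H.coeff u = Finsupp.single 0 (H.coeff u 0) := by
      ext i
      rcases Nat.eq_zero_or_pos i with rfl | hi
      · simp
      · rw [hl.2 i hi, Finsupp.single_eq_of_ne hi.ne']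
    conv_lhs => rw [H.coeff_spec u, this, Finsupp.sum_single_index (by simp)]
    simp
  refine ⟨C (H.coeff u 0)⁻¹, ?_⟩
  have hinv : C (H.coeff u 0)⁻¹ * u = 1 := by
    conv_lhs => rw [hu]
    rw [H.coeff_C, Finsupp.single_eq_same, ← map_mul, inv_mul_cancel₀ hl.1, map_one]
  rw [← mul_assoc, hinv, one_mul]

theorem exists_eq_mul_X_sub_C_add_C (H : IsOreExtension σ (fun _ => 0) R C X) (b : L) (r : R) :
    ∃ (u : R) (d : L), r = u * (X - C b) + C d := by
  induction r using H.induction_monomial with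
  | zero => exact ⟨0, 0, by simp⟩
  | add r s hr hs =>
    obtain ⟨u, d, rfl⟩ := hr
    obtain ⟨v, e, rfl⟩ := hs
    exact ⟨u + v, d + e, by rw [add_mul, map_add]; abel⟩
  | monomial c n =>
    induction n generalizing c with
    | zero => exact ⟨0, c, by simp⟩
    | succ n ih =>
      obtain ⟨u, d, hu⟩ := ih (c * (⇑σ)^[n] b)
      refine ⟨C c * X ^ n + u, d, ?_⟩
      rw [add_mul, add_assoc, ← hu, map_mul, mul_assoc (C c) (C _), ← H.X_pow_mul_C, pow_succ]
      noncomm_ring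

end Multiplication

end IsOreExtension

/-- The subfield of elements fixed by `σ`. -/
abbrev fixedSubfield {L : Type*} [Field L] (σ : L ≃+* L) : Subfield L :=
  (σ : L →+* L).eqLocusField (RingHom.id L)

section Action

variable {L : Type*} [Field L] {σ : L ≃+* L} {R : Type*} [Ring R] {C : L →+* R} {X : R}

/-- The map `c ↦ σ c * a`, which is linear over the fixed field of `σ`. -/
def twistedEnd (σ : L ≃+* L) (a : L) : Module.End (fixedSubfield σ) L where
  toFun c := σ c * a
  map_add' c d := by rw [map_add, add_mul]
  map_smul' t c := by
    have ht : σ (t : L) = t := t.2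
    simp only [Algebra.smul_def, RingHom.id_apply, map_mul]
    change σ (t : L) * σ c * a = (t : L) * (σ c * a)
    rw [ht, mul_assoc]

theorem twistedEnd_apply (a c : L) : twistedEnd σ a c = σ c * a := rfl

theorem twistedEnd_pow_mul (a b c : L) (n : ℕ) :
    (twistedEnd σ a ^ n) (b * c) = (⇑σ)^[n] b * (twistedEnd σ a ^ n) c := by
  induction n with
  | zero => simp
  | succ n ih =>
    rw [pow_succ', Module.End.mul_apply, Module.End.mul_apply, ih, twistedEnd_apply,
      twistedEnd_apply, map_mul, Function.iterate_succ_apply', mul_assoc]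

theorem twistedEnd_pow_apply (a c : L) (n : ℕ) :
    (twistedEnd σ a ^ n) c = (⇑σ)^[n] c * Nrm σ n a := by
  induction n generalizing c with
  | zero => simp [Nrm]
  | succ n ih =>
    rw [pow_succ, Module.End.mul_apply, ih, twistedEnd_apply, iterate_map_mul, Nrm, Nrm,
      Finset.prod_range_succ, Function.iterate_succ_apply]
    ring

namespace IsOreExtension

/-- The action of an Ore polynomial on `L` in which `X` acts as `c ↦ σ c * a`. -/
noncomputable def act (H : IsOreExtension σ (fun _ => 0) R C X) (a : L) (r : R) :
    Module.End (fixedSubfield σ) L :=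
  (H.coeff r).sum fun n b => LinearMap.mulLeft (fixedSubfield σ) b * twistedEnd σ a ^ n

variable (H : IsOreExtension σ (fun _ => 0) R C X) (a : L)

theorem act_C_mul_X_pow (b : L) (n : ℕ) :
    H.act a (C b * X ^ n) = LinearMap.mulLeft (fixedSubfield σ) b * twistedEnd σ a ^ n := by
  rw [act, H.coeff_C_mul_X_pow, Finsupp.sum_single_index]
  ext
  simp

theorem act_zero : H.act a 0 = 0 := by
  rw [act, H.coeff_zero, Finsupp.sum_zero_index]

theorem act_add (r s : R) : H.act a (r + s) = H.act a r + H.act a s := by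
  rw [act, H.coeff_add, Finsupp.sum_add_index']
  · rfl
  · intro n
    ext
    simp
  · intro n b c
    ext
    simp [add_mul]

theorem act_sub (r s : R) : H.act a (r - s) = H.act a r - H.act a s := by
  rw [eq_sub_iff_add_eq, ← act_add, sub_add_cancel]

theorem act_mul (r s : R) : H.act a (r * s) = H.act a r * H.act a s := by
  induction r using H.induction_monomial with
  | zero => simp [act_zero]
  | add r r' hr hr' => rw [add_mul, act_add, hr, hr', act_add, add_mul]
  | monomial b n =>
    induction s using H.induction_monomial with
    | zero => simp [act_zero]
    | add s s' hs hs' => rw [mul_add, act_add, hs, hs', act_add, mul_add]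
    | monomial c k =>
      rw [H.monomial_mul_monomial]
      simp only [act_C_mul_X_pow]
      ext x
      simp only [Module.End.mul_apply, LinearMap.mulLeft_apply]
      rw [twistedEnd_pow_mul, pow_add, Module.End.mul_apply, mul_assoc]

theorem act_C (b c : L) : H.act a (C b) c = b * c := by
  have := H.act_C_mul_X_pow a b 0
  rw [pow_zero, mul_one] at this
  simp [this]

theorem act_X_pow (n : ℕ) (c : L) : H.act a (X ^ n) c = (⇑σ)^[n] c * Nrm σ n a := by
  have := H.act_C_mul_X_pow a 1 n
  rw [map_one, one_mul] at this
  rw [this, ← twistedEnd_pow_apply]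
  simp

theorem act_X_sub_C (b c : L) : H.act a (X - C b) c = σ c * a - b * c := by
  have := H.act_X_pow a 1 c
  rw [pow_one] at this
  rw [act_sub, LinearMap.sub_apply, act_C, this]
  simp [Nrm]

theorem act_one (c : L) : H.act a 1 c = c := by
  simpa using H.act_C a 1 c

theorem act_X_pow_sub_C_nrm {μ : ℕ} (hord : ∀ a : L, (⇑σ)^[μ] a = a) (c : L) :
    H.act a (X ^ μ - C (Nrm σ μ a)) c = 0 := by
  rw [act_sub, LinearMap.sub_apply, act_X_pow, act_C, hord, mul_comm, sub_self]

theorem rDvd_X_sub_C_iff {c b : L} (hc : c ≠ 0) (hb : b = σ c * a * c⁻¹) (r : R) :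
    RDvd (X - C b) r ↔ H.act a r c = 0 := by
  have h0 : H.act a (X - C b) c = 0 := by
    rw [act_X_sub_C, hb, inv_mul_cancel_right₀ hc, sub_self]
  constructor
  · rintro ⟨u, rfl⟩
    rw [act_mul, Module.End.mul_apply, h0, map_zero]
  · intro h
    obtain ⟨u, d, rfl⟩ := H.exists_eq_mul_X_sub_C_add_C b r
    rw [act_add, act_mul, LinearMap.add_apply, Module.End.mul_apply, h0, map_zero, zero_add,
      act_C] at h
    rw [(mul_eq_zero.1 h).resolve_right hc]
    exact ⟨u, by simp⟩

/-- The annihilator of finitely many elements of `L` is generated by an Ore polynomial whose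
kernel is their span, and whose degree detects their linear independence. -/
theorem exists_generator_annihilator (ha : a ≠ 0) (m : ℕ) (c : Fin m → L) :
    ∃ (r : R) (k : ℕ), H.deg r = (k : WithBot ℕ) ∧ k ≤ m ∧
      (k = m ↔ LinearIndependent (fixedSubfield σ) c) ∧
      (∀ s, RDvd r s ↔ ∀ j, H.act a s (c j) = 0) ∧
      (∀ x, H.act a r x = 0 → x ∈ Submodule.span (fixedSubfield σ) (Set.range c)) := by
  induction m with
  | zero =>
    refine ⟨1, 0, H.deg_one, le_rfl, ?_, fun s => ?_, fun x hx => ?_⟩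
    · simp
    · exact ⟨fun _ j => j.elim0, fun _ => ⟨s, by simp⟩⟩
    · rw [act_one] at hx
      simp [hx]
  | succ m ih =>
    obtain ⟨r, k, hk, hkm, hind, hann, hker⟩ := ih (Fin.init c)
    have hmem : ∀ x, x ∈ Submodule.span (fixedSubfield σ) (Set.range (Fin.init c)) →
        H.act a r x = 0 := fun x hx => by
      have hle : Submodule.span (fixedSubfield σ) (Set.range (Fin.init c)) ≤
          LinearMap.ker (H.act a r) := by
        rw [Submodule.span_le]
        rintro _ ⟨j, rfl⟩
        exact (hann r).1 ⟨1, by simp⟩ j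
      exact hle hx
    have hle : Submodule.span (fixedSubfield σ) (Set.range (Fin.init c)) ≤
        Submodule.span (fixedSubfield σ) (Set.range c) :=
      Submodule.span_mono (by rintro _ ⟨j, rfl⟩; exact ⟨j.castSucc, rfl⟩)
    set d := H.act a r (c (Fin.last m)) with hd
    by_cases hd0 : d = 0
    · refine ⟨r, k, hk, by omega, ?_, fun s => ?_, fun x hx => hle (hker x hx)⟩
      · rw [linearIndependent_finSucc']
        exact iff_of_false (by omega) fun h => h.2 (hker _ hd0)
      · rw [hann, Fin.forall_fin_succ']
        refine ⟨fun h => ⟨h, ?_⟩, fun h => h.1⟩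
        obtain ⟨u, rfl⟩ := (hann s).2 h
        rw [act_mul, Module.End.mul_apply, ← hd, hd0, map_zero]
    · have hdeg : H.deg (X - C (σ d * a * d⁻¹)) = ((1 : ℕ) : WithBot ℕ) := by
        simpa using H.deg_X_pow_sub_C one_pos (σ d * a * d⁻¹)
      refine ⟨(X - C (σ d * a * d⁻¹)) * r, 1 + k, H.deg_mul hdeg hk, by omega, ?_,
        fun s => ?_, fun x hx => ?_⟩
      · rw [linearIndependent_finSucc', ← hind]
        exact ⟨fun h => ⟨by omega, fun h' => hd0 (hmem _ h')⟩, fun h => by omega⟩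
      · rw [Fin.forall_fin_succ']
        constructor
        · rintro ⟨u, rfl⟩
          refine ⟨(hann _).1 ⟨u * (X - C (σ d * a * d⁻¹)), (mul_assoc _ _ _).symm⟩, ?_⟩
          rw [← mul_assoc, act_mul, Module.End.mul_apply, ← hd]
          exact (H.rDvd_X_sub_C_iff a hd0 rfl _).1 ⟨u, rfl⟩
        · rintro ⟨h, h'⟩
          obtain ⟨u, rfl⟩ := (hann s).2 h
          rw [act_mul, Module.End.mul_apply, ← hd] at h'
          obtain ⟨v, rfl⟩ := (H.rDvd_X_sub_C_iff a hd0 rfl _).2 h'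
          exact ⟨v, mul_assoc _ _ _⟩
      · rw [act_mul, Module.End.mul_apply, act_X_sub_C, sub_eq_zero] at hx
        have ht : σ (H.act a r x / d) = H.act a r x / d := by
          have hσd : σ d ≠ 0 := (map_ne_zero σ).2 hd0
          rw [map_div₀, div_eq_div_iff hσd hd0]
          apply mul_right_cancel₀ ha
          rw [mul_right_comm, hx]
          field_simp
        let t : fixedSubfield σ := ⟨H.act a r x / d, ht⟩
        have hxt : x - t • c (Fin.last m) ∈
            Submodule.span (fixedSubfield σ) (Set.range (Fin.init c)) := by
          apply hker
          rw [map_sub, map_smul, ← hd, sub_eq_zero]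
          exact (div_mul_cancel₀ _ hd0).symm
        rw [← sub_add_cancel x (t • c (Fin.last m))]
        exact Submodule.add_mem _ (hle hxt)
          (Submodule.smul_mem _ _ (Submodule.subset_span ⟨_, rfl⟩))

theorem deg_eq_of_isLclm {ι : Type*} {f : ι → R} {r s : R} {n : ℕ}
    (hr : IsLclm f r) (hs : IsLclm f s) (hn : H.deg r = (n : WithBot ℕ)) :
    H.deg s = (n : WithBot ℕ) :=
  H.deg_eq_of_rDvd_rDvd hn (hr.2 s hs.1) (hs.2 r hr.1)

/-- A family of conjugates of `a` is left P-independent exactly when the conjugating elements are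
linearly independent over the fixed field. -/
theorem exists_isLclm_deg_eq_iff (ha : a ≠ 0) {m : ℕ} {c β : Fin m → L}
    (hc : ∀ j, c j ≠ 0 ∧ β j = σ (c j) * a * (c j)⁻¹) :
    (∃ r : R, IsLclm (fun j => X - C (β j)) r ∧ H.deg r = (m : WithBot ℕ)) ↔
      LinearIndependent (fixedSubfield σ) c := by
  obtain ⟨r, k, hk, -, hind, hann, -⟩ := H.exists_generator_annihilator a ha m c
  have hdvd : ∀ s, RDvd r s ↔ ∀ j, RDvd (X - C (β j)) s := fun s => by
    rw [hann]
    exact forall_congr' fun j => (H.rDvd_X_sub_C_iff a (hc j).1 (hc j).2 s).symm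
  have hr : IsLclm (fun j => X - C (β j)) r :=
    ⟨(hdvd r).1 ⟨1, by simp⟩, fun s hs => (hdvd s).2 hs⟩
  rw [← hind]
  constructor
  · rintro ⟨s, hs, hm⟩
    have := hk.symm.trans (H.deg_eq_of_isLclm hs hr hm)
    exact_mod_cast this
  · rintro rfl
    exact ⟨r, hr, hk⟩

end IsOreExtension

end Action

theorem linearIndependent_fixedSubfield_iff {L : Type*} [Field L] {σ : L ≃+* L} {m : ℕ}
    {c : Fin m → L} :
    LinearIndependent (fixedSubfield σ) c ↔
      ∀ t : Fin m → L, (∀ j, σ (t j) = t j) → ∑ j, t j * c j = 0 → ∀ j, t j = 0 := by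
  rw [Fintype.linearIndependent_iff]
  constructor
  · intro h t ht hsum j
    exact congrArg Subtype.val (h (fun j => ⟨t j, ht j⟩) hsum j)
  · intro h t hsum j
    exact Subtype.ext (h (fun j => (t j : L)) (fun j => (t j).2) hsum j)

/-- Proposition 16 of the paper: for `a ∈ L*`, a family of distinct elements of
`Δ(a)` is left P-independent iff it can be written as `β j = σ (c j) * a * (c j)⁻¹`
with `(c j)` linearly independent over the fixed field `K = L^σ` (and then `m ≤ μ`);
moreover, for such a P-independent family, `m = μ` iff
`lclm {x - β j} = x^μ - N a`. -/
theorem pindependent_subsets_of_conjugacy_class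
    {L : Type*} [Field L] (σ : L ≃+* L) (μ : ℕ) (hμ : 0 < μ)
    (hord : ∀ a : L, (⇑σ)^[μ] a = a)
    (hord' : ∀ i : ℕ, 0 < i → i < μ → ∃ a : L, (⇑σ)^[i] a ≠ a)
    {R : Type*} [Ring R] (C : L →+* R) (X : R)
    (H : IsOreExtension σ (fun _ => 0) R C X)
    (a : L) (ha : a ≠ 0) (m : ℕ) (β : Fin m → L)
    (hβinj : Function.Injective β) (hβ : ∀ j, β j ∈ Delta σ a) :
    ((∃ Λ : R, IsLclm (fun j : Fin m => X - C (β j)) Λ ∧ H.deg Λ = (m : WithBot ℕ)) ↔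
      (m ≤ μ ∧ ∃ cc : Fin m → L,
        (∀ j, cc j ≠ 0 ∧ β j = σ (cc j) * a * (cc j)⁻¹) ∧
        (∀ t : Fin m → L, (∀ j, σ (t j) = t j) → ∑ j, t j * cc j = 0 → ∀ j, t j = 0))) ∧
    ((∃ Λ : R, IsLclm (fun j : Fin m => X - C (β j)) Λ ∧ H.deg Λ = (m : WithBot ℕ)) →
      (m = μ ↔ IsLclm (fun j : Fin m => X - C (β j)) (X ^ μ - C (Nrm σ μ a)))) := by
  have hN : H.deg (X ^ μ - C (Nrm σ μ a)) = (μ : WithBot ℕ) := H.deg_X_pow_sub_C hμ _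
  choose c hc using hβ
  have hdvd : ∀ j, RDvd (X - C (β j)) (X ^ μ - C (Nrm σ μ a)) := fun j =>
    (H.rDvd_X_sub_C_iff a (hc j).1 (hc j).2 _).2 (H.act_X_pow_sub_C_nrm a hord _)
  refine ⟨⟨?_, ?_⟩, ?_⟩
  · rintro ⟨Λ, hΛ, hm⟩
    exact ⟨H.deg_le_of_rDvd hm hN (hΛ.2 _ hdvd), c, hc,
      linearIndependent_fixedSubfield_iff.1
        ((H.exists_isLclm_deg_eq_iff a ha hc).1 ⟨Λ, hΛ, hm⟩)⟩
  · rintro ⟨-, d, hd, hind⟩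
    exact (H.exists_isLclm_deg_eq_iff a ha hd).2 (linearIndependent_fixedSubfield_iff.2 hind)
  · rintro ⟨Λ, hΛ, hm⟩
    constructor
    · rintro rfl
      obtain ⟨u, hu⟩ := H.rDvd_symm_of_deg_eq hm hN (hΛ.2 _ hdvd)
      refine ⟨hdvd, fun s hs => ?_⟩
      obtain ⟨v, rfl⟩ := hΛ.2 s hs
      exact ⟨v * u, by rw [mul_assoc, ← hu]⟩
    · intro h
      have := (H.deg_eq_of_isLclm hΛ h hm).symm.trans hN
      exact_mod_cast this
end
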